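/- arXiv:1709.00596 — 2 statements merged into one kernel-verified Lean document; each statement's English description precedes it below -/
import Mathlib

section
/- Let Ψ be a planar-monotone-style CNF instance with n variables and m clauses, and let G_Ψ be the associated domination graph. If S is a dominating set of G_Ψ with cardinality exactly n, then Ψ is satisfiable; in fact, any assignment a : Fin n → Bool with a i = true whenever v_i ∈ S and a i = false whenever v̄_i ∈ S satisfies Ψ. -/
/-- A planar-monotone-style CNF instance with `n` variables and `m` clauses:
clause `h` consists of the set of variable indices `L h` together with a sign
`eps h` (`true` = all literals unnegated, `false` = all negated). -/
structure PMCnf (n m : ℕ) where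
  L : Fin m → Finset (Fin n)
  eps : Fin m → Bool

/-- An assignment `a` satisfies `Ψ` if every clause contains a variable whose
value agrees with the sign of the clause. -/
def PMCnf.Satisfies {n m : ℕ} (Ψ : PMCnf n m) (a : Fin n → Bool) : Prop :=
  ∀ h : Fin m, ∃ i ∈ Ψ.L h, a i = Ψ.eps h

/-- The closed neighborhood `Γ(S)` of a set of vertices. -/
def closedNbhd {V : Type*} (G : SimpleGraph V) (S : Set V) : Set V :=
  S ∪ {v | ∃ s ∈ S, G.Adj v s}

/-- `S` is a dominating set if `Γ(S) = V`. -/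
def IsDominating {V : Type*} (G : SimpleGraph V) (S : Set V) : Prop :=
  closedNbhd G S = Set.univ

/-- Vertices of the domination graph `G_Ψ`: for each variable `i` the four
vertices `v_i = (i,0)`, `v̄_i = (i,1)`, `u_i = (i,2)`, `w_i = (i,3)`, and for
each clause `h` a vertex `z_h`. -/
abbrev DomVert (n m : ℕ) := (Fin n × Fin 4) ⊕ Fin m

/-- The base relation generating the edges of `G_Ψ`: the four vertices of each
variable gadget are pairwise adjacent, and `z_h` is adjacent to `v_i`
(resp. `v̄_i`) for each `i ∈ L h` when `eps h` is `true` (resp. `false`). -/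
def domRel {n m : ℕ} (Ψ : PMCnf n m) : DomVert n m → DomVert n m → Prop
  | Sum.inl (i, _), Sum.inl (j, _) => i = j
  | Sum.inl (i, a), Sum.inr h => i ∈ Ψ.L h ∧ a = (if Ψ.eps h then 0 else 1)
  | Sum.inr h, Sum.inl (i, a) => i ∈ Ψ.L h ∧ a = (if Ψ.eps h then 0 else 1)
  | Sum.inr _, Sum.inr _ => False

/-- The domination graph `G_Ψ` associated to the CNF instance `Ψ`. -/
def domGraph {n m : ℕ} (Ψ : PMCnf n m) : SimpleGraph (DomVert n m) :=
  SimpleGraph.fromRel (domRel Ψ)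

/-- The closed neighborhood of `S` contains `u_i` only if `S` meets the gadget of variable `i`. -/
theorem IsDominating.exists_mem_gadget {n m : ℕ} {Ψ : PMCnf n m} {S : Set (DomVert n m)}
    (hS : IsDominating (domGraph Ψ) S) (i : Fin n) :
    ∃ x : Fin 4, (Sum.inl (i, x) : DomVert n m) ∈ S := by
  have hu : (Sum.inl (i, 2) : DomVert n m) ∈ closedNbhd (domGraph Ψ) S := by
    rw [hS]
    trivial
  rcases hu with hu | ⟨s, hs, hadj⟩
  · exact ⟨2, hu⟩
  rw [domGraph, SimpleGraph.fromRel_adj] at hadj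
  rcases s with ⟨j, x⟩ | h
  · have hij : i = j := hadj.2.elim id Eq.symm
    exact ⟨x, hij ▸ hs⟩
  · have hlit : (2 : Fin 4) = if Ψ.eps h then 0 else 1 := hadj.2.elim And.right And.right
    split at hlit <;> simp at hlit

/-- A dominating set of cardinality `n` consists of exactly one vertex from each gadget. -/
theorem IsDominating.exists_eq_range {n m : ℕ} {Ψ : PMCnf n m} {S : Set (DomVert n m)}
    (hS : IsDominating (domGraph Ψ) S) (hcard : S.ncard = n) :
    ∃ x : Fin n → Fin 4, S = Set.range fun i => (Sum.inl (i, x i) : DomVert n m) := by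
  choose x hx using hS.exists_mem_gadget
  refine ⟨x, (Set.eq_of_subset_of_ncard_le (Set.range_subset_iff.2 hx) ?_ S.toFinite).symm⟩
  have hinj : Function.Injective fun i => (Sum.inl (i, x i) : DomVert n m) := fun i j hij =>
    congrArg Prod.fst (Sum.inl_injective hij)
  rw [hcard, ← Set.image_univ, Set.ncard_image_of_injective _ hinj, Set.ncard_univ, Nat.card_fin]

/-- If a dominating set omits `z_h`, then it contains a literal vertex of clause `h`. -/
theorem IsDominating.exists_literal_mem {n m : ℕ} {Ψ : PMCnf n m} {S : Set (DomVert n m)}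
    (hS : IsDominating (domGraph Ψ) S) {h : Fin m} (hh : (Sum.inr h : DomVert n m) ∉ S) :
    ∃ i ∈ Ψ.L h, (Sum.inl (i, if Ψ.eps h then 0 else 1) : DomVert n m) ∈ S := by
  have hz : (Sum.inr h : DomVert n m) ∈ closedNbhd (domGraph Ψ) S := by
    rw [hS]
    trivial
  obtain ⟨s, hs, hadj⟩ := hz.resolve_left hh
  rw [domGraph, SimpleGraph.fromRel_adj] at hadj
  rcases s with ⟨i, x⟩ | k
  · have hlit : i ∈ Ψ.L h ∧ x = if Ψ.eps h then 0 else 1 := hadj.2.elim id id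
    exact ⟨i, hlit.1, hlit.2 ▸ hs⟩
  · exact (hadj.2.elim id id : False).elim

/-- If `S` is a dominating set of `G_Ψ` of cardinality exactly
`n`, then `Ψ` is satisfiable; in fact, any assignment `a` with `a i = true`
whenever `v_i ∈ S` and `a i = false` whenever `v̄_i ∈ S` satisfies `Ψ`. -/
theorem domGraph_satisfiable_of_dominating_card {n m : ℕ} (Ψ : PMCnf n m)
    (S : Set (DomVert n m)) (hS : IsDominating (domGraph Ψ) S)
    (hcard : S.ncard = n) :
    (∃ a : Fin n → Bool, Ψ.Satisfies a) ∧
      ∀ a : Fin n → Bool,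
        (∀ i : Fin n, (Sum.inl (i, 0) : DomVert n m) ∈ S → a i = true) →
        (∀ i : Fin n, (Sum.inl (i, 1) : DomVert n m) ∈ S → a i = false) →
        Ψ.Satisfies a := by
  obtain ⟨x, hx⟩ := hS.exists_eq_range hcard
  have hmem : ∀ i y, (Sum.inl (i, y) : DomVert n m) ∈ S ↔ x i = y := by simp [hx]
  have key : ∀ a : Fin n → Bool,
      (∀ i : Fin n, (Sum.inl (i, 0) : DomVert n m) ∈ S → a i = true) →
      (∀ i : Fin n, (Sum.inl (i, 1) : DomVert n m) ∈ S → a i = false) →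
      Ψ.Satisfies a := by
    intro a htrue hfalse h
    obtain ⟨i, hi, hs⟩ := hS.exists_literal_mem (h := h) (by simp [hx])
    refine ⟨i, hi, ?_⟩
    cases heps : Ψ.eps h
    · exact hfalse i (by simpa [heps] using hs)
    · exact htrue i (by simpa [heps] using hs)
  refine ⟨⟨fun i => decide (x i = 0), key _ ?_ ?_⟩, key⟩
  · intro i hi
    simpa using (hmem i 0).1 hi
  · intro i hi
    simp [(hmem i 1).1 hi]
end

section
/- Let Ψ be a planar-monotone-style CNF instance with n variables in which every clause has |L_h| ∈ {2,3}, and let G'_Ψ be the associated power-domination graph. Then G'_Ψ has a power dominating set of cardinality at most n if and only if there exists a set S of cardinality exactly n with Γ₁(Γ(S)) equal to the full vertex set (i.e., the power domination process already terminates after one propagation step). -/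
/-- `S₁(A)`: the vertices of `A` having exactly one neighbor outside `A`. -/
def pdS1 {V : Type*} (G : SimpleGraph V) (A : Set V) : Set V :=
  {s ∈ A | ∃! v, v ∉ A ∧ G.Adj s v}

/-- The propagation operator `Γ₁(A) = A ∪ Γ(S₁(A))`. -/
def pdStep {V : Type*} (G : SimpleGraph V) (A : Set V) : Set V :=
  A ∪ closedNbhd G (pdS1 G A)

/-- `S` is a power dominating set if iterating `Γ₁` starting from `Γ(S)`
eventually covers all vertices. -/
def IsPowerDominating {V : Type*} (G : SimpleGraph V) (S : Set V) : Prop :=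
  ∃ k : ℕ, (pdStep G)^[k] (closedNbhd G S) = Set.univ

/-- Validity predicate for clause-gadget vertices of `G'_Ψ`: `(h, Sum.inl l)`
is the vertex `z_{h,l}` (requires `l ∈ L h`), and `(h, Sum.inr 0)`,
`(h, Sum.inr 1)` are the vertices `z_{h,h}`, `v_{h,h}` (present only when
clause `h` has exactly two literals). -/
def ClauseOk {n m : ℕ} (Ψ : PMCnf n m) : Fin m × (Fin n ⊕ Fin 2) → Prop
  | (h, Sum.inl l) => l ∈ Ψ.L h
  | (h, Sum.inr _) => (Ψ.L h).card = 2

/-- Vertices of the power-domination graph `G'_Ψ`: for each variable `i` the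
six vertices `v_i = (i,0)`, `v̄_i = (i,1)`, `u_i = (i,2)`, `v'_i = (i,3)`,
`v̄'_i = (i,4)`, `u'_i = (i,5)`, together with the clause-gadget vertices. -/
abbrev PVert {n m : ℕ} (Ψ : PMCnf n m) :=
  (Fin n × Fin 6) ⊕ {p : Fin m × (Fin n ⊕ Fin 2) // ClauseOk Ψ p}

/-- The base relation generating the edges of `G'_Ψ`.
* Within a variable gadget, `(i,a)` and `(i,b)` are adjacent iff
  `a ≢ b (mod 3)`, i.e. all pairs except `(v_i,v'_i)`, `(v̄_i,v̄'_i)`,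
  `(u_i,u'_i)` (and loops) are edges.
* A clause-gadget vertex of clause `h` with slot `q` is adjacent to the
  literal vertex `w_i` (`= v_i` or `v̄_i` according to `eps h`) for each
  `i ∈ L h`, except that `z_{h,l}` is not adjacent to `w_l` itself.
* Two clause-gadget vertices are adjacent iff they belong to the same clause,
  are distinct, and are not the pair `(z_{h,h}, v_{h,h})`. -/
def pdRel {n m : ℕ} (Ψ : PMCnf n m) : PVert Ψ → PVert Ψ → Prop
  | Sum.inl (i, a), Sum.inl (j, b) => i = j ∧ a.val % 3 ≠ b.val % 3
  | Sum.inl (i, a), Sum.inr ⟨(h, q), _⟩ =>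
      a = (if Ψ.eps h then 0 else 1) ∧ i ∈ Ψ.L h ∧ ∀ l, q = Sum.inl l → l ≠ i
  | Sum.inr ⟨(h, q), _⟩, Sum.inl (i, a) =>
      a = (if Ψ.eps h then 0 else 1) ∧ i ∈ Ψ.L h ∧ ∀ l, q = Sum.inl l → l ≠ i
  | Sum.inr ⟨(h, q), _⟩, Sum.inr ⟨(h', q'), _⟩ =>
      h = h' ∧ q ≠ q' ∧ (q.isLeft = true ∨ q'.isLeft = true)

/-- The power-domination graph `G'_Ψ` associated to the CNF instance `Ψ`. -/
def pdGraph {n m : ℕ} (Ψ : PMCnf n m) : SimpleGraph (PVert Ψ) :=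
  SimpleGraph.fromRel (pdRel Ψ)

/-- The literal vertex `w_l` of clause `h`: `v_l` if `eps h = true`,
`v̄_l` if `eps h = false`. -/
def wV {n m : ℕ} (Ψ : PMCnf n m) (h : Fin m) (l : Fin n) : PVert Ψ :=
  Sum.inl (l, if Ψ.eps h then 0 else 1)

/-- The clause-gadget vertex `z_{h,l}` (for `l ∈ L h`). -/
def zV {n m : ℕ} (Ψ : PMCnf n m) (h : Fin m) (l : Fin n) (hl : l ∈ Ψ.L h) :
    PVert Ψ :=
  Sum.inr ⟨(h, Sum.inl l), hl⟩

/-- The clause-gadget vertex `z_{h,h}` (for a clause with two literals). -/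
def zhhV {n m : ℕ} (Ψ : PMCnf n m) (h : Fin m) (hc : (Ψ.L h).card = 2) :
    PVert Ψ :=
  Sum.inr ⟨(h, Sum.inr 0), hc⟩

/-- The clause-gadget vertex `v_{h,h}` (for a clause with two literals). -/
def vhhV {n m : ℕ} (Ψ : PMCnf n m) (h : Fin m) (hc : (Ψ.L h).card = 2) :
    PVert Ψ :=
  Sum.inr ⟨(h, Sum.inr 1), hc⟩

section General

variable {V : Type*} {G : SimpleGraph V}

theorem disjoint_fort_pdStep {A F : Set V}
    (hF : ∀ s ∉ F, ∀ v ∈ F, G.Adj s v → ∃ w ∈ F, w ≠ v ∧ G.Adj s w)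
    (hA : Disjoint F A) : Disjoint F (pdStep G A) := by
  rw [Set.disjoint_left] at hA ⊢
  rintro v hv (hvA | hvS | ⟨s, ⟨hsA, u, -, huniq⟩, hvs⟩)
  · exact hA hv hvA
  · exact hA hv hvS.1
  · obtain ⟨w, hwF, hwv, hsw⟩ := hF s (fun hs => hA hs hsA) v hv hvs.symm
    exact hwv ((huniq w ⟨hA hwF, hsw⟩).trans (huniq v ⟨hA hv, hvs.symm⟩).symm)

/-- A power dominating set meets the closed neighborhood of every nonempty fort, i.e. of every
set `F` such that no vertex outside `F` has exactly one neighbor in `F`. -/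
theorem IsPowerDominating.exists_mem_closedNbhd_fort {S F : Set V}
    (hS : IsPowerDominating G S) (hne : F.Nonempty)
    (hF : ∀ s ∉ F, ∀ v ∈ F, G.Adj s v → ∃ w ∈ F, w ≠ v ∧ G.Adj s w) :
    ∃ v ∈ F, v ∈ closedNbhd G S := by
  by_contra! hdis
  obtain ⟨k, hk⟩ := hS
  have key : ∀ k, Disjoint F ((pdStep G)^[k] (closedNbhd G S)) := by
    intro k
    induction k with
    | zero => exact Set.disjoint_left.2 hdis
    | succ k ih =>
      rw [Function.iterate_succ_apply']
      exact disjoint_fort_pdStep hF ih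
  obtain ⟨v, hv⟩ := hne
  exact Set.disjoint_left.1 (key k) hv (hk ▸ Set.mem_univ v)

theorem pdStep_eq_univ {A : Set V}
    (h : ∀ x ∉ A, ∃ s ∈ A, G.Adj s x ∧ ∀ y ∉ A, G.Adj s y → y = x) :
    pdStep G A = Set.univ := by
  refine Set.eq_univ_of_forall fun x => ?_
  by_cases hx : x ∈ A
  · exact Or.inl hx
  · obtain ⟨s, hsA, hsx, huniq⟩ := h x hx
    exact Or.inr (Or.inr ⟨s, ⟨hsA, x, ⟨hx, hsx⟩, fun y hy => huniq y hy.1 hy.2⟩, hsx.symm⟩)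

end General

section PdGraph

variable {n m : ℕ} {Ψ : PMCnf n m}

theorem pdGraph_adj_inl_inl {i j : Fin n} {a b : Fin 6} :
    (pdGraph Ψ).Adj (Sum.inl (i, a)) (Sum.inl (j, b)) ↔ i = j ∧ a.val % 3 ≠ b.val % 3 := by
  simp only [pdGraph, SimpleGraph.fromRel_adj, pdRel]
  grind

theorem pdGraph_adj_inl_inr {i : Fin n} {a : Fin 6} {h : Fin m} {q : Fin n ⊕ Fin 2}
    {hq : ClauseOk Ψ (h, q)} :
    (pdGraph Ψ).Adj (Sum.inl (i, a)) (Sum.inr ⟨(h, q), hq⟩) ↔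
      a = (if Ψ.eps h then 0 else 1) ∧ i ∈ Ψ.L h ∧ q ≠ Sum.inl i := by
  simp only [pdGraph, SimpleGraph.fromRel_adj, pdRel]
  grind

theorem pdGraph_adj_inr_inr {h h' : Fin m} {q q' : Fin n ⊕ Fin 2}
    {hq : ClauseOk Ψ (h, q)} {hq' : ClauseOk Ψ (h', q')} :
    (pdGraph Ψ).Adj (Sum.inr ⟨(h, q), hq⟩) (Sum.inr ⟨(h', q'), hq'⟩) ↔
      h = h' ∧ q ≠ q' ∧ (q.isLeft = true ∨ q'.isLeft = true) := by
  simp only [pdGraph, SimpleGraph.fromRel_adj, pdRel]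
  grind

theorem exists_mem_variable_gadget {S : Set (PVert Ψ)} (hS : IsPowerDominating (pdGraph Ψ) S)
    (i : Fin n) : ∃ a : Fin 6, Sum.inl (i, a) ∈ S := by
  obtain ⟨v, hv, hvS⟩ := hS.exists_mem_closedNbhd_fort
    (F := {Sum.inl (i, 2), Sum.inl (i, 5)}) ⟨_, Or.inl rfl⟩ (by
      rintro (⟨j, a⟩ | ⟨⟨h, q⟩, hq⟩) - v (rfl | rfl) hadj
      · exact ⟨_, Or.inr rfl, by simp, by simpa [pdGraph_adj_inl_inl] using hadj⟩
      · exact ⟨_, Or.inl rfl, by simp, by simpa [pdGraph_adj_inl_inl] using hadj⟩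
      · rw [SimpleGraph.adj_comm, pdGraph_adj_inl_inr] at hadj
        split_ifs at hadj <;> simp at hadj
      · rw [SimpleGraph.adj_comm, pdGraph_adj_inl_inr] at hadj
        split_ifs at hadj <;> simp at hadj)
  have huS : ∀ a : Fin 6, 2 ≤ a.val → Sum.inl (i, a) ∈ closedNbhd (pdGraph Ψ) S →
      ∃ a : Fin 6, Sum.inl (i, a) ∈ S := by
    rintro a ha (haS | ⟨⟨j, b⟩ | ⟨⟨h, q⟩, hq⟩, hs, hadj⟩)
    · exact ⟨_, haS⟩
    · obtain ⟨rfl, -⟩ := pdGraph_adj_inl_inl.1 hadj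
      exact ⟨b, hs⟩
    · rw [pdGraph_adj_inl_inr] at hadj
      split_ifs at hadj <;> simp [hadj.1] at ha
  rcases hv with rfl | rfl
  · exact huS _ (by simp) hvS
  · exact huS _ (by simp) hvS

theorem exists_other_clause_slot {h : Fin m}
    (hsz : (Ψ.L h).card = 2 ∨ (Ψ.L h).card = 3) {l : Fin n} (hl : l ∈ Ψ.L h)
    (q : Fin n ⊕ Fin 2) : ∃ q', ClauseOk Ψ (h, q') ∧ q' ≠ q ∧ q' ≠ Sum.inl l := by
  rcases hsz with h2 | h3
  · by_cases hq : q = Sum.inr 0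
    · exact ⟨Sum.inr 1, h2, by simp [hq], by simp⟩
    · exact ⟨Sum.inr 0, h2, Ne.symm hq, by simp⟩
  · have hcard : 1 < ((Ψ.L h).erase l).card := by rw [Finset.card_erase_of_mem hl]; omega
    obtain ⟨j, hj, k, hk, hjk⟩ := Finset.one_lt_card.1 hcard
    rw [Finset.mem_erase] at hj hk
    by_cases hq : q = Sum.inl j
    · exact ⟨Sum.inl k, hk.2, by simp [hq, hjk.symm], by simp [hk.1]⟩
    · exact ⟨Sum.inl j, hj.2, Ne.symm hq, by simp [hj.1]⟩

theorem exists_mem_clause_gadget {S : Set (PVert Ψ)} (hS : IsPowerDominating (pdGraph Ψ) S)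
    (h : Fin m) (hsz : (Ψ.L h).card = 2 ∨ (Ψ.L h).card = 3) :
    (∃ p, Sum.inr p ∈ S) ∨ ∃ l ∈ Ψ.L h, wV Ψ h l ∈ S := by
  have hne : (Ψ.L h).Nonempty := Finset.card_pos.1 (by omega)
  obtain ⟨l, hl⟩ := hne
  obtain ⟨v, ⟨q, hq, rfl⟩, hvS⟩ := hS.exists_mem_closedNbhd_fort
    (F := {v | ∃ q, ∃ hq : ClauseOk Ψ (h, q), v = Sum.inr ⟨(h, q), hq⟩})
    ⟨_, Sum.inl l, hl, rfl⟩ (by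
      rintro (⟨j, a⟩ | ⟨⟨h', q'⟩, hq'⟩) hs v ⟨q, hq, rfl⟩ hadj
      · obtain ⟨ha, hj, -⟩ := pdGraph_adj_inl_inr.1 hadj
        obtain ⟨q', hq', hne, hne'⟩ := exists_other_clause_slot hsz hj q
        exact ⟨_, ⟨q', hq', rfl⟩, by simpa using hne, pdGraph_adj_inl_inr.2 ⟨ha, hj, hne'⟩⟩
      · obtain ⟨rfl, -⟩ := pdGraph_adj_inr_inr.1 hadj
        exact (hs ⟨q', hq', rfl⟩).elim)
  rcases hvS with hvS | ⟨⟨j, b⟩ | p, hs, hadj⟩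
  · exact Or.inl ⟨_, hvS⟩
  · obtain ⟨rfl, hj, -⟩ := pdGraph_adj_inl_inr.1 hadj.symm
    exact Or.inr ⟨j, hj, hs⟩
  · exact Or.inl ⟨p, hs⟩

theorem exists_satisfies_of_isPowerDominating
    (hsz : ∀ h : Fin m, (Ψ.L h).card = 2 ∨ (Ψ.L h).card = 3) {S : Set (PVert Ψ)}
    (hS : IsPowerDominating (pdGraph Ψ) S) (hcard : S.ncard ≤ n) :
    ∃ a : Fin n → Bool, Ψ.Satisfies a := by
  choose f hf using exists_mem_variable_gadget hS
  have hinj : Function.Injective fun i => (Sum.inl (i, f i) : PVert Ψ) := fun i j hij => by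
    simpa using congrArg (Sum.map Prod.fst id) hij
  have hrange : Set.range (fun i => (Sum.inl (i, f i) : PVert Ψ)) = S := by
    refine Set.eq_of_subset_of_ncard_le (Set.range_subset_iff.2 hf) ?_ S.toFinite
    rwa [Set.ncard_range_of_injective hinj, Nat.card_fin]
  refine ⟨fun i => decide (f i = 0), fun h => ?_⟩
  rcases exists_mem_clause_gadget hS h (hsz h) with ⟨p, hp⟩ | ⟨l, hl, hw⟩
  · simp [← hrange] at hp
  · rw [← hrange] at hw
    obtain ⟨i, hi⟩ := hw
    obtain ⟨rfl, hfi⟩ : i = l ∧ f i = if Ψ.eps h then 0 else 1 := by simpa [wV] using hi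
    refine ⟨i, hl, ?_⟩
    cases he : Ψ.eps h <;> simp [hfi, he]

/-- The literal vertices made true by the assignment `a`. -/
def assignmentVerts (Ψ : PMCnf n m) (a : Fin n → Bool) : Set (PVert Ψ) :=
  Set.range fun i => Sum.inl (i, if a i then 0 else 1)

theorem ncard_assignmentVerts (a : Fin n → Bool) : (assignmentVerts Ψ a).ncard = n := by
  have hinj : Function.Injective
      fun i => (Sum.inl (i, if a i then 0 else 1) : PVert Ψ) := fun i j hij => by
    simpa using congrArg (Sum.map Prod.fst id) hij
  rw [assignmentVerts, Set.ncard_range_of_injective hinj, Nat.card_fin]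

theorem eq_of_inl_notMem_closedNbhd {a : Fin n → Bool} {i : Fin n} {b : Fin 6}
    (hb : Sum.inl (i, b) ∉ closedNbhd (pdGraph Ψ) (assignmentVerts Ψ a)) :
    b = if a i then 3 else 4 := by
  have h1 : ¬ b = if a i then 0 else 1 := fun h => hb (Or.inl ⟨i, by simp [h]⟩)
  have h2 : ¬ b.val % 3 ≠ (if a i then 0 else 1 : Fin 6).val % 3 := fun h =>
    hb (Or.inr ⟨_, ⟨i, rfl⟩, pdGraph_adj_inl_inl.2 ⟨rfl, h⟩⟩)
  clear hb
  generalize a i = t at *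
  decide +revert

theorem eq_of_inr_notMem_closedNbhd {a : Fin n → Bool} {h : Fin m} {q : Fin n ⊕ Fin 2}
    {hq : ClauseOk Ψ (h, q)} {l : Fin n} (hl : l ∈ Ψ.L h) (hal : a l = Ψ.eps h)
    (hx : Sum.inr ⟨(h, q), hq⟩ ∉ closedNbhd (pdGraph Ψ) (assignmentVerts Ψ a)) :
    q = Sum.inl l := by
  by_contra hne
  exact hx (Or.inr ⟨_, ⟨l, rfl⟩, (pdGraph_adj_inl_inr.2 ⟨by simp [hal], hl, hne⟩).symm⟩)

theorem PMCnf.Satisfies.pdStep_eq_univ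
    (hsz : ∀ h : Fin m, (Ψ.L h).card = 2 ∨ (Ψ.L h).card = 3) {a : Fin n → Bool}
    (ha : Ψ.Satisfies a) :
    pdStep (pdGraph Ψ) (closedNbhd (pdGraph Ψ) (assignmentVerts Ψ a)) = Set.univ := by
  apply _root_.pdStep_eq_univ
  rintro (⟨i, b⟩ | ⟨⟨h, q⟩, hq⟩) hx
  · obtain rfl := eq_of_inl_notMem_closedNbhd hx
    refine ⟨Sum.inl (i, 5), ?_, ?_, ?_⟩
    · by_contra hu
      have := eq_of_inl_notMem_closedNbhd hu
      split_ifs at this <;> simp at this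
    · rw [pdGraph_adj_inl_inl]
      split_ifs <;> simp
    · rintro (⟨j, b⟩ | ⟨⟨h, q⟩, hq⟩) hy hadj
      · obtain ⟨rfl, -⟩ := pdGraph_adj_inl_inl.1 hadj
        rw [eq_of_inl_notMem_closedNbhd hy]
      · have := (pdGraph_adj_inl_inr.1 hadj).1
        split_ifs at this <;> simp at this
  · obtain ⟨l, hl, hal⟩ := ha h
    obtain rfl := eq_of_inr_notMem_closedNbhd hl hal hx
    obtain ⟨j, hj, hjl⟩ := Finset.exists_mem_ne (s := Ψ.L h) (by have := hsz h; omega) l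
    refine ⟨zV Ψ h j hj, ?_, ?_, ?_⟩
    · by_contra hz
      exact hjl (Sum.inl_injective (eq_of_inr_notMem_closedNbhd hl hal hz))
    · exact pdGraph_adj_inr_inr.2 ⟨rfl, by simpa using hjl, Or.inl rfl⟩
    · rintro (⟨i, b⟩ | ⟨⟨h', q⟩, hq'⟩) hy hadj
      · have hb := (pdGraph_adj_inl_inr.1 hadj.symm).1
        rw [eq_of_inl_notMem_closedNbhd hy] at hb
        split_ifs at hb <;> simp at hb
      · obtain ⟨rfl, -⟩ := pdGraph_adj_inr_inr.1 hadj
        obtain rfl := eq_of_inr_notMem_closedNbhd hl hal hy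
        rfl

end PdGraph

/-- `G'_Ψ` has a power dominating set of cardinality at most
`n` iff there is a set of cardinality exactly `n` for which the process already
terminates after one propagation step. -/
theorem pdGraph_powerDominating_iff_one_step {n m : ℕ} (Ψ : PMCnf n m)
    (hsz : ∀ h : Fin m, (Ψ.L h).card = 2 ∨ (Ψ.L h).card = 3) :
    (∃ S : Set (PVert Ψ), IsPowerDominating (pdGraph Ψ) S ∧ S.ncard ≤ n) ↔
      ∃ S : Set (PVert Ψ), S.ncard = n ∧
        pdStep (pdGraph Ψ) (closedNbhd (pdGraph Ψ) S) = Set.univ := by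
  constructor
  · rintro ⟨S, hS, hcard⟩
    obtain ⟨a, ha⟩ := exists_satisfies_of_isPowerDominating hsz hS hcard
    exact ⟨assignmentVerts Ψ a, ncard_assignmentVerts a, ha.pdStep_eq_univ hsz⟩
  · rintro ⟨S, hcard, hS⟩
    exact ⟨S, ⟨1, hS⟩, hcard.le⟩
end
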